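/- Let n ≥ 4 be an integer and let α_0, …, α_{n−2}, β_0, …, β_{n−2}, γ_0, γ_1, γ_2 be real numbers, not all zero, and define on (0,∞) the function F(h) = Σ_{k=0}^{n−2} α_k h^{k+1} + √(h(4+h)) Σ_{k=0}^{n−2} β_k h^k + (γ_0 + γ_1 h + γ_2 h²) · ln((2 + h + √(h(4+h)))/2). Then F has at most 2n zeros in (0,∞). -/

import Mathlib

open Real

open Polynomial in
/-- The radicand `h (4 + h)` as a polynomial. -/
noncomputable def radicand : ℝ[X] := X ^ 2 + 4 * X

open Polynomial in
/-- The polynomial `Q` with `(P S ^ s)' = Q S ^ (s - 1)`, where `S` is `radicand`. -/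
noncomputable def twistedDeriv (s : ℝ) (P : ℝ[X]) : ℝ[X] :=
  radicand * derivative P + C (2 * s) * ((X + 2) * P)

open Polynomial in
/-- The polynomial `W` with `(P S ^ s)^(k) = W S ^ (s - k)` for `s = 5 / 2`. -/
noncomputable def twistedIter (P : ℝ[X]) : ℕ → ℝ[X]
  | 0 => P
  | k + 1 => twistedDeriv (5 / 2 - k) (twistedIter P k)

/-- `f` vanishes identically on `(0, ∞)` or has at most `k` zeros there. -/
def ZeroBound (f : ℝ → ℝ) (k : ℕ) : Prop :=
  (∀ x, 0 < x → f x = 0) ∨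
    ∀ T : Finset ℝ, (∀ x ∈ T, 0 < x ∧ f x = 0) → T.card ≤ k

theorem exists_finset_deriv_zeros {f f' : ℝ → ℝ} (s : Finset ℝ) :
    (∀ a ∈ s, f a = 0) → (∀ a ∈ s, ∀ b ∈ s, ContinuousOn f (Set.Icc a b)) →
    (∀ a ∈ s, ∀ x, a < x → HasDerivAt f (f' x) x) →
    ∃ t : Finset ℝ, (∀ y ∈ t, f' y = 0 ∧ (∃ a ∈ s, a < y) ∧ ∃ b ∈ s, y < b) ∧
      s.card ≤ t.card + 1 := by
  induction s using Finset.induction_on_max with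
  | empty => intro _ _ _; exact ⟨∅, by simp⟩
  | insert a s ha ih =>
    intro hz hc hd
    obtain ⟨t, ht, hcard⟩ := ih (fun x hx => hz x (Finset.mem_insert_of_mem hx))
      (fun x hx y hy => hc x (Finset.mem_insert_of_mem hx) y (Finset.mem_insert_of_mem hy))
      (fun x hx => hd x (Finset.mem_insert_of_mem hx))
    have has : a ∉ s := fun h => lt_irrefl _ (ha a h)
    rcases s.eq_empty_or_nonempty with rfl | hs
    · exact ⟨∅, by simp⟩
    have hbs := s.max'_mem hs
    set b := s.max' hs
    have hbi : b ∈ insert a s := Finset.mem_insert_of_mem hbs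
    have hai : a ∈ insert a s := Finset.mem_insert_self a s
    obtain ⟨y, hy, hy0⟩ := exists_hasDerivAt_eq_zero (f' := f') (ha b hbs) (hc b hbi a hai)
      (by rw [hz b hbi, hz a hai]) (fun x hx => hd b hbi x hx.1)
    have hyt : y ∉ t := by
      intro h
      obtain ⟨-, -, c, hcs, hyc⟩ := ht y h
      exact absurd (s.le_max' c hcs) (not_le.2 (hy.1.trans hyc))
    refine ⟨insert y t, ?_, ?_⟩
    · intro x hx
      rcases Finset.mem_insert.1 hx with rfl | hx
      · exact ⟨hy0, ⟨b, hbi, hy.1⟩, a, hai, hy.2⟩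
      · obtain ⟨h1, ⟨c, hcs, hcx⟩, d, hds, hxd⟩ := ht x hx
        exact ⟨h1, ⟨c, Finset.mem_insert_of_mem hcs, hcx⟩, d, Finset.mem_insert_of_mem hds, hxd⟩
    · rw [Finset.card_insert_of_notMem has, Finset.card_insert_of_notMem hyt]
      omega

theorem eq_zero_of_hasDerivAt_zero {f f' : ℝ → ℝ} (hd : ∀ x, 0 < x → HasDerivAt f (f' x) x)
    (h0 : ∀ x, 0 < x → f' x = 0) {a : ℝ} (ha : 0 < a) (hfa : f a = 0) {x : ℝ} (hx : 0 < x) :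
    f x = 0 := by
  rw [← hfa]
  refine isOpen_Ioi.is_const_of_deriv_eq_zero (s := Set.Ioi (0 : ℝ)) isPreconnected_Ioi
    (fun y hy => (hd y hy).differentiableAt.differentiableWithinAt) ?_ hx ha
  intro y hy
  rw [(hd y hy).deriv, h0 y hy, Pi.zero_apply]

namespace ZeroBound

theorem of_hasDerivAt {f f' : ℝ → ℝ} {k : ℕ} (hd : ∀ x, 0 < x → HasDerivAt f (f' x) x)
    (h : ZeroBound f' k) : ZeroBound f (k + 1) := by
  rcases h with h | h
  · by_cases hz : ∃ a, 0 < a ∧ f a = 0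
    · obtain ⟨a, ha, hfa⟩ := hz
      exact Or.inl fun x hx => eq_zero_of_hasDerivAt_zero hd h ha hfa hx
    · refine Or.inr fun T hT => ?_
      rcases T.eq_empty_or_nonempty with rfl | ⟨a, ha⟩
      · simp
      · exact absurd ⟨a, hT a ha⟩ hz
  · refine Or.inr fun T hT => ?_
    obtain ⟨t, ht, hcard⟩ := exists_finset_deriv_zeros (f := f) (f' := f') T
      (fun a ha => (hT a ha).2)
      (fun a ha b _ x hx =>
        (hd x ((hT a ha).1.trans_le hx.1)).continuousAt.continuousWithinAt)
      (fun a ha x hx => hd x ((hT a ha).1.trans hx))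
    have := h t fun y hy => by
      obtain ⟨h1, ⟨a, ha, hay⟩, -⟩ := ht y hy
      exact ⟨(hT a ha).1.trans hay, h1⟩
    omega

theorem of_iterate {f : ℕ → ℝ → ℝ} (hd : ∀ j x, 0 < x → HasDerivAt (f j) (f (j + 1) x) x)
    {K : ℕ} (N : ℕ) (h : ZeroBound (f N) K) : ZeroBound (f 0) (K + N) := by
  induction N generalizing K with
  | zero => exact h
  | succ N ih =>
    have := ih (of_hasDerivAt (hd N) h)
    rwa [add_assoc, add_comm 1 N] at this

theorem congr {f g : ℝ → ℝ} {k : ℕ} (h : ZeroBound f k)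
    (hfg : ∀ x, 0 < x → (g x = 0 ↔ f x = 0)) : ZeroBound g k := by
  rcases h with h | h
  · exact Or.inl fun x hx => (hfg x hx).2 (h x hx)
  · exact Or.inr fun T hT => h T fun x hx => ⟨(hT x hx).1, (hfg x (hT x hx).1).1 (hT x hx).2⟩

theorem eval (P : Polynomial ℝ) {k : ℕ} (hP : P.natDegree ≤ k) :
    ZeroBound (fun x => P.eval x) k := by
  by_cases h0 : P = 0
  · exact Or.inl fun x _ => by simp [h0]
  · refine Or.inr fun T hT => le_trans ?_ hP
    by_contra hlt
    exact h0 (Polynomial.eq_zero_of_natDegree_lt_card_of_eval_eq_zero' P T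
      (fun x hx => (hT x hx).2) (not_le.1 hlt))

end ZeroBound

section Twisted

open Polynomial

theorem radicand_eval_pos {x : ℝ} (hx : 0 < x) : 0 < radicand.eval x := by
  simp only [radicand, eval_add, eval_pow, eval_X, eval_mul, eval_ofNat]
  positivity

theorem natDegree_radicand_le : radicand.natDegree ≤ 2 := by
  unfold radicand; compute_degree

theorem hasDerivAt_eval_mul_rpow (s : ℝ) (P : ℝ[X]) {x : ℝ} (hx : 0 < x) :
    HasDerivAt (fun y => P.eval y * radicand.eval y ^ s)
      ((twistedDeriv s P).eval x * radicand.eval x ^ (s - 1)) x := by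
  have hS := radicand_eval_pos hx
  have h := (P.hasDerivAt x).mul
    ((radicand.hasDerivAt x).rpow_const (p := s) (Or.inl hS.ne'))
  refine h.congr_deriv ?_
  have h1 : radicand.eval x ^ s = radicand.eval x * radicand.eval x ^ (s - 1) := by
    rw [Real.rpow_sub_one hS.ne']; field_simp
  have h2 : (derivative radicand).eval x = 2 * (x + 2) := by
    simp [radicand]; ring
  rw [h1, h2]
  simp only [twistedDeriv, eval_add, eval_mul, eval_C, eval_X, eval_ofNat]
  ring

theorem natDegree_twistedDeriv_le (s : ℝ) {P : ℝ[X]} {m : ℕ} (hP : P.natDegree ≤ m) :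
    (twistedDeriv s P).natDegree ≤ m + 1 := by
  unfold twistedDeriv
  refine natDegree_add_le_of_degree_le ?_ ?_
  · rcases Nat.eq_zero_or_pos P.natDegree with h | h
    · rw [derivative_of_natDegree_zero h]; simp
    · refine (natDegree_mul_le_of_le natDegree_radicand_le (natDegree_derivative_le P)).trans ?_
      omega
  · refine (natDegree_C_mul_le _ _).trans ?_
    refine (natDegree_mul_le_of_le (m := 1) (n := m) ?_ hP).trans (by omega)
    compute_degree

theorem twistedDeriv_add (s : ℝ) (P Q : ℝ[X]) :
    twistedDeriv s (P + Q) = twistedDeriv s P + twistedDeriv s Q := by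
  simp only [twistedDeriv, derivative_add]; ring

theorem twistedDeriv_C_mul (s a : ℝ) (P : ℝ[X]) :
    twistedDeriv s (C a * P) = C a * twistedDeriv s P := by
  simp only [twistedDeriv, derivative_C_mul]; ring

theorem twistedIter_add (P Q : ℝ[X]) (k : ℕ) :
    twistedIter (P + Q) k = twistedIter P k + twistedIter Q k := by
  induction k with
  | zero => rfl
  | succ k ih => simp only [twistedIter, ih, twistedDeriv_add]

theorem twistedIter_C_mul (a : ℝ) (P : ℝ[X]) (k : ℕ) :
    twistedIter (C a * P) k = C a * twistedIter P k := by
  induction k with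
  | zero => rfl
  | succ k ih => simp only [twistedIter, ih, twistedDeriv_C_mul]

/-- Leibniz rule for `X * P`. -/
theorem twistedIter_X_mul (P : ℝ[X]) (k : ℕ) :
    twistedIter (X * P) (k + 1) =
      X * twistedIter P (k + 1) + C ((k : ℝ) + 1) * (radicand * twistedIter P k) := by
  induction k with
  | zero =>
    simp only [twistedIter, twistedDeriv, derivative_mul, derivative_X]
    simp; ring
  | succ k ih =>
    rw [twistedIter, ih]
    have e1 : twistedIter P (k + 1) = twistedDeriv (5 / 2 - k) (twistedIter P k) := rfl
    have e2 : twistedIter P (k + 1 + 1) =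
      twistedDeriv (5 / 2 - (k + 1 : ℕ)) (twistedIter P (k + 1)) := rfl
    rw [twistedDeriv_add, twistedDeriv_C_mul]
    have h1 : ∀ s (Q : ℝ[X]), twistedDeriv s (X * Q) = X * twistedDeriv s Q + radicand * Q := by
      intro s Q
      simp only [twistedDeriv, derivative_mul, derivative_X]; ring
    have h2 : ∀ s (Q : ℝ[X]),
        twistedDeriv (s - 1) (radicand * Q) = radicand * twistedDeriv s Q := by
      intro s Q
      have : derivative radicand = 2 * (X + 2) := by
        simp [radicand]; ring
      simp only [twistedDeriv, derivative_mul, this, mul_sub, C_sub, C_mul]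
      simp only [C_1, show (C (2 : ℝ) : ℝ[X]) = 2 from rfl]
      ring
    have h3 : (5 / 2 - ((k + 1 : ℕ) : ℝ)) = (5 / 2 - (k : ℝ)) - 1 := by push_cast; ring
    rw [h1, h3, h2, ← e1, ← h3, ← e2]
    push_cast
    simp only [C_add]
    simp only [C_1]
    ring

theorem twistedIter_one_six : ∃ a, twistedIter 1 6 = C a := by
  have step : ∀ (j : ℕ) (c : ℤ) (P Q : ℝ[X]), twistedIter 1 j = P → c = 5 - 2 * (j : ℤ) →
      radicand * derivative P + (c : ℝ[X]) * ((X + 2) * P) = Q → twistedIter 1 (j + 1) = Q := by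
    rintro j c P Q rfl rfl rfl
    rw [twistedIter, twistedDeriv, ← C_eq_intCast]
    congr 3
    push_cast
    ring
  have c2 : (C 2 : ℝ[X]) = 2 := rfl
  have c3 : (C 3 : ℝ[X]) = 3 := rfl
  have c4 : (C 4 : ℝ[X]) = 4 := rfl
  have c5 : (C 5 : ℝ[X]) = 5 := rfl
  have w1 := step 0 5 1 (5 * (X + 2)) rfl (by norm_num) (by simp)
  have w2 := step 1 3 _ (20 * (X + 2) ^ 2 - 20) w1 (by norm_num) (by simp [radicand]; ring)
  have w3 := step 2 1 _ (60 * (X + 2) ^ 3 - 180 * (X + 2)) w2 (by norm_num)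
    (by simp [radicand, derivative_pow, c2]; ring)
  have w4 := step 3 (-1) _ (120 * (X + 2) ^ 4 - 720 * (X + 2) ^ 2 + 720) w3 (by norm_num)
    (by simp [radicand, derivative_pow, c3]; ring)
  have w5 := step 4 (-3) _ (120 * (X + 2) ^ 5 - 1200 * (X + 2) ^ 3 + 3600 * (X + 2)) w4
    (by norm_num) (by simp [radicand, derivative_pow, c2, c4]; ring)
  have w6 := step 5 (-5) _ (-14400) w5 (by norm_num)
    (by simp [radicand, derivative_pow, c3, c5]; ring)
  exact ⟨-14400, by rw [w6, C_neg]; rfl⟩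

theorem natDegree_twistedIter_le (m : ℕ) : ∀ P : ℝ[X], P.natDegree ≤ m →
    (twistedIter P (m + 6)).natDegree ≤ m := by
  induction m with
  | zero =>
    intro P hP
    obtain ⟨a, ha⟩ := twistedIter_one_six
    rw [eq_C_of_natDegree_le_zero hP, ← mul_one (C _), twistedIter_C_mul, zero_add, ha]
    exact ((C_mul (R := ℝ)).symm ▸ natDegree_C _).le
  | succ m ih =>
    intro P hP
    have hone : ∀ k, (twistedIter 1 (k + 6)).natDegree ≤ k := by
      intro k
      induction k with
      | zero => obtain ⟨a, ha⟩ := twistedIter_one_six; simp [ha]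
      | succ k ihk => exact natDegree_twistedDeriv_le _ ihk
    have hsplit : P = X * divX P + C (P.coeff 0) * 1 := by
      rw [mul_one, X_mul_divX_add]
    have hQ := ih (divX P) (by rw [natDegree_divX_eq_natDegree_tsub_one]; omega)
    rw [hsplit, twistedIter_add, twistedIter_C_mul]
    refine natDegree_add_le_of_degree_le ?_ ((natDegree_C_mul_le _ _).trans (hone (m + 1)))
    rw [show m + 1 + 6 = (m + 6) + 1 by ring, twistedIter_X_mul, twistedIter]
    set W := twistedIter (divX P) (m + 6)
    rw [natDegree_le_iff_coeff_eq_zero] at hQ ⊢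
    intro N hN
    obtain ⟨i, rfl⟩ : ∃ i, N = i + 2 := ⟨N - 2, by omega⟩
    have hder : ∀ j, (X * derivative W).coeff j = j * W.coeff j := by
      intro j
      cases j with
      | zero => simp
      | succ j => rw [coeff_X_mul, coeff_derivative]; push_cast; ring
    have hexp : X * twistedDeriv (5 / 2 - ((m + 6 : ℕ) : ℝ)) W
          + C (((m + 6 : ℕ) : ℝ) + 1) * (radicand * W)
        = X * (X * (X * derivative W)) + C 4 * (X * (X * derivative W))
          + C (2 * (5 / 2 - ((m + 6 : ℕ) : ℝ))) * (X * (X * W) + C 2 * (X * W))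
          + C (((m + 6 : ℕ) : ℝ) + 1) * (X * (X * W) + C 4 * (X * W)) := by
      simp only [twistedDeriv, radicand, show (C (2 : ℝ) : ℝ[X]) = 2 from rfl,
        show (C (4 : ℝ) : ℝ[X]) = 4 from rfl]
      ring
    rw [hexp]
    simp only [coeff_add, coeff_C_mul, coeff_X_mul, hder]
    have hi1 : W.coeff (i + 1) = 0 := hQ _ (by omega)
    rcases (show m ≤ i by omega).eq_or_lt with rfl | hlt
    · rw [hi1]; push_cast; ring
    · rw [hi1, hQ i hlt]; ring

theorem zeroBound_add_mul_rpow {p q : ℝ[X]} {m : ℕ} (hp : p.natDegree ≤ m)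
    (hq : q.natDegree ≤ m + 5) :
    ZeroBound (fun x => p.eval x + q.eval x * radicand.eval x ^ (-(5 / 2) : ℝ))
      (m + (m + 6)) := by
  set f : ℕ → ℝ → ℝ := fun j x =>
    (twistedIter p j).eval x * radicand.eval x ^ (5 / 2 - j : ℝ) + (derivative^[j] q).eval x
  have hd : ∀ j x, 0 < x → HasDerivAt (f j) (f (j + 1) x) x := by
    intro j x hx
    have h := (hasDerivAt_eval_mul_rpow (5 / 2 - j) (twistedIter p j) hx).add
      ((derivative^[j] q).hasDerivAt x)
    refine h.congr_deriv ?_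
    simp only [f, twistedIter, Function.iterate_succ_apply']
    push_cast
    rw [sub_sub]
  have hN : ZeroBound (f (m + 6)) m := by
    refine (ZeroBound.eval _ (natDegree_twistedIter_le m p hp)).congr fun x hx => ?_
    have h0 : derivative^[m + 6] q = 0 := iterate_derivative_eq_zero (by omega)
    simp [f, h0, (Real.rpow_pos_of_pos (radicand_eval_pos hx) _).ne']
  refine (ZeroBound.of_iterate hd _ hN).congr fun x hx => ?_
  have hS := Real.rpow_pos_of_pos (radicand_eval_pos hx) (5 / 2)
  have : f 0 x = (p.eval x + q.eval x * radicand.eval x ^ (-(5 / 2) : ℝ)) *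
      radicand.eval x ^ (5 / 2 : ℝ) := by
    simp only [f, twistedIter, Real.rpow_neg (radicand_eval_pos hx).le]
    simp
    field_simp
  rw [this, mul_eq_zero, or_iff_left hS.ne']

end Twisted

section LogCombination

open Polynomial

theorem sqrt_eq_radicand_rpow (x : ℝ) :
    √(x * (4 + x)) = radicand.eval x ^ (1 / 2 : ℝ) := by
  rw [Real.sqrt_eq_rpow]
  congr 1
  simp [radicand]; ring

theorem hasDerivAt_log_sqrt {x : ℝ} (hx : 0 < x) :
    HasDerivAt (fun y => Real.log ((2 + y + √(y * (4 + y))) / 2))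
      (radicand.eval x ^ (-(1 / 2) : ℝ)) x := by
  have hS : 0 < x * (4 + x) := by positivity
  have hr : 0 < √(x * (4 + x)) := Real.sqrt_pos.2 hS
  have h1 : HasDerivAt (fun y : ℝ => y * (4 + y)) (1 * (4 + x) + x * 1) x :=
    (hasDerivAt_id x).mul ((hasDerivAt_id x).const_add 4)
  have h2 := ((((hasDerivAt_id x).const_add 2).add (h1.sqrt hS.ne')).div_const 2).log
    (by simp only [id, Pi.add_apply]; positivity)
  refine h2.congr_deriv ?_
  rw [Real.rpow_neg (radicand_eval_pos hx).le, ← sqrt_eq_radicand_rpow]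
  simp only [id, Pi.add_apply]
  field_simp
  ring

/-- The combination `A + B S ^ s + R L` with `L` the logarithm of the theorem. -/
noncomputable def logComb (A B R : ℝ[X]) (s : ℝ) (x : ℝ) : ℝ :=
  A.eval x + B.eval x * radicand.eval x ^ s +
    R.eval x * Real.log ((2 + x + √(x * (4 + x))) / 2)

theorem hasDerivAt_logComb (A B R : ℝ[X]) (k : ℕ) {x : ℝ} (hx : 0 < x) :
    HasDerivAt (logComb A B R (1 / 2 - k))
      (logComb (derivative A) (twistedDeriv (1 / 2 - k) B + radicand ^ k * R) (derivative R)
        (1 / 2 - (k + 1 : ℕ)) x) x := by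
  have hS := radicand_eval_pos hx
  have h := ((A.hasDerivAt x).add (hasDerivAt_eval_mul_rpow (1 / 2 - k) B hx)).add
    ((R.hasDerivAt x).mul (hasDerivAt_log_sqrt hx))
  refine h.congr_deriv ?_
  have e : radicand.eval x ^ (-(1 / 2) : ℝ) =
      radicand.eval x ^ k * radicand.eval x ^ (1 / 2 - (k + 1 : ℕ) : ℝ) := by
    rw [← Real.rpow_natCast, ← Real.rpow_add hS]
    congr 1; push_cast; ring
  rw [e]
  simp only [logComb, eval_add, eval_mul, eval_pow]
  push_cast
  rw [sub_sub]
  ring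

theorem eq_zero_of_aeval_cosh {P : ℝ[X]}
    (h : ∀ z : ℂ, aeval (2 * Complex.cosh z - 2) P = 0) : P = 0 := by
  refine map_injective (algebraMap ℝ ℂ) (algebraMap ℝ ℂ).injective ?_
  rw [Polynomial.map_zero]
  refine Polynomial.funext fun w => ?_
  obtain ⟨u, hu⟩ := Complex.cos_surjective ((w + 2) / 2)
  have := h (u * Complex.I)
  rw [Complex.cosh_mul_I, hu, aeval_def, ← eval_map] at this
  rw [eval_zero, ← this]
  congr 1; ring

theorem logComb_half_eq_zero {A B R : ℝ[X]}
    (h : ∀ x, 0 < x → logComb A B R (1 / 2) x = 0) : A = 0 ∧ B = 0 ∧ R = 0 := by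
  set w : ℂ → ℂ := fun z => 2 * Complex.cosh z - 2
  set G : ℂ → ℂ := fun z => aeval (w z) A + 2 * Complex.sinh z * aeval (w z) B
    + z * aeval (w z) R
  have hw : Differentiable ℂ w := by fun_prop
  have hae : ∀ P : ℝ[X], Differentiable ℂ fun z => aeval (w z) P := fun P =>
    Differentiable.comp (g := fun y : ℂ => aeval y P) (Polynomial.differentiable_aeval P) hw
  have hG : Differentiable ℂ G :=
    ((hae A).add (((Complex.differentiable_sinh).const_mul 2).mul (hae B))).add
      (differentiable_id.mul (hae R))
  have hreal : ∀ t : ℝ, 0 < t → G t = 0 := by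
    intro t ht
    have hs : 0 < Real.sinh t := Real.sinh_pos_iff.2 ht
    have hc : 1 < Real.cosh t := Real.one_lt_cosh.2 ht.ne'
    have h1 := h (2 * Real.cosh t - 2) (by linarith)
    have h2 : √((2 * Real.cosh t - 2) * (4 + (2 * Real.cosh t - 2))) = 2 * Real.sinh t := by
      rw [Real.sqrt_eq_iff_mul_self_eq_of_pos (by positivity)]
      nlinarith [Real.cosh_sq t]
    rw [logComb, ← sqrt_eq_radicand_rpow, h2,
      show (2 + (2 * Real.cosh t - 2) + 2 * Real.sinh t) / 2 = Real.exp t by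
        rw [← Real.cosh_add_sinh]; ring, Real.log_exp] at h1
    have hwt : w t = algebraMap ℝ ℂ (2 * Real.cosh t - 2) := by simp [w]
    simp only [G, hwt, aeval_algebraMap_apply, coe_aeval_eq_eval]
    simp only [Complex.coe_algebraMap]
    rw [← Complex.ofReal_sinh]
    norm_cast
    linarith
  have hG0 : ∀ z, G z = 0 := by
    have hfr : ∃ᶠ z in nhdsWithin (1 : ℂ) {1}ᶜ, G z = 0 := by
      have ht : Filter.Tendsto (fun t : ℝ => (t : ℂ)) (nhdsWithin 1 {1}ᶜ)
          (nhdsWithin (1 : ℂ) {1}ᶜ) := by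
        refine tendsto_nhdsWithin_iff.2 ⟨?_, ?_⟩
        · exact (Complex.continuous_ofReal.tendsto' 1 1 (by simp)).mono_left nhdsWithin_le_nhds
        · filter_upwards [self_mem_nhdsWithin] with t ht
          simpa using ht
      refine ht.frequently (Filter.Eventually.frequently ?_)
      filter_upwards [nhdsWithin_le_nhds (Ioi_mem_nhds (zero_lt_one' ℝ))] with t ht
      exact hreal t ht
    have han : AnalyticOnNhd ℂ G Set.univ := fun z _ => hG.analyticAt z
    intro z
    exact han.eqOn_zero_of_preconnected_of_frequently_eq_zero isPreconnected_univ
      (Set.mem_univ 1) hfr (Set.mem_univ z)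
  have hR : R = 0 := by
    refine eq_zero_of_aeval_cosh fun z => ?_
    have h1 := hG0 (z + 2 * π * Complex.I)
    have h2 := hG0 z
    have hc : Complex.cosh (z + 2 * π * Complex.I) = Complex.cosh z := by
      simp [Complex.cosh, Complex.exp_add, Complex.exp_neg, Complex.exp_two_pi_mul_I]
    have hs : Complex.sinh (z + 2 * π * Complex.I) = Complex.sinh z := by
      simp [Complex.sinh, Complex.exp_add, Complex.exp_neg, Complex.exp_two_pi_mul_I]
    simp only [G, w, hc, hs] at h1 h2
    have h3 : (2 * π * Complex.I) * aeval (2 * Complex.cosh z - 2) R = 0 := by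
      linear_combination h1 - h2
    exact (mul_eq_zero.1 h3).resolve_left Complex.two_pi_I_ne_zero
  have hA : A = 0 := by
    refine eq_zero_of_aeval_cosh fun z => ?_
    have h1 := hG0 (-z)
    have h2 := hG0 z
    simp only [G, w, Complex.cosh_neg, Complex.sinh_neg, hR, map_zero] at h1 h2
    linear_combination (h1 + h2) / 2
  have hB : radicand * B = 0 := by
    refine eq_zero_of_aeval_cosh fun z => ?_
    have h2 := hG0 z
    simp only [G, w, hR, hA, map_zero] at h2
    have e : aeval (2 * Complex.cosh z - 2) radicand = (2 * Complex.sinh z) ^ 2 := by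
      simp only [radicand, map_add, map_mul, map_pow, aeval_X, map_ofNat]
      linear_combination 4 * Complex.cosh_sq z
    rw [map_mul, e]
    linear_combination 2 * Complex.sinh z * h2
  have hne : radicand ≠ 0 := fun h0 => by
    have := radicand_eval_pos one_pos
    simp [h0] at this
  exact ⟨hA, (mul_eq_zero.1 hB).resolve_left hne, hR⟩

theorem card_zeros_logComb_le {A B R : ℝ[X]} {n : ℕ} (hn : 4 ≤ n) (hA : A.natDegree ≤ n - 1)
    (hA0 : A.eval 0 = 0) (hB : B.natDegree ≤ n - 2) (hR : R.natDegree ≤ 2)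
    (hne : ¬ (A = 0 ∧ B = 0 ∧ R = 0)) (T : Finset ℝ)
    (hT : ∀ x ∈ T, 0 < x ∧ logComb A B R (1 / 2) x = 0) : T.card ≤ 2 * n := by
  set B1 := twistedDeriv (1 / 2 - (0 : ℕ)) B + radicand ^ 0 * R with hB1
  set B2 := twistedDeriv (1 / 2 - (1 : ℕ)) B1 + radicand ^ 1 * derivative R with hB2
  set B3 := twistedDeriv (1 / 2 - (2 : ℕ)) B2 + radicand ^ 2 * derivative (derivative R) with hB3
  have dR : (derivative R).natDegree ≤ 1 := (natDegree_derivative_le R).trans (by omega)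
  have ddR : (derivative (derivative R)).natDegree ≤ 0 :=
    (natDegree_derivative_le _).trans (by omega)
  have dddR : derivative (derivative (derivative R)) = 0 :=
    derivative_of_natDegree_zero (by omega)
  have hS : ∀ k, (radicand ^ k).natDegree ≤ k * 2 := fun k =>
    natDegree_pow_le_of_le k natDegree_radicand_le
  have nB1 : B1.natDegree ≤ n - 1 := natDegree_add_le_of_degree_le
    ((natDegree_twistedDeriv_le _ hB).trans (by omega))
    ((natDegree_mul_le_of_le (hS 0) hR).trans (by omega))
  have nB2 : B2.natDegree ≤ n := natDegree_add_le_of_degree_le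
    ((natDegree_twistedDeriv_le _ nB1).trans (by omega))
    ((natDegree_mul_le_of_le (hS 1) dR).trans (by omega))
  have nB3 : B3.natDegree ≤ n - 4 + 5 := natDegree_add_le_of_degree_le
    ((natDegree_twistedDeriv_le _ nB2).trans (by omega))
    ((natDegree_mul_le_of_le (hS 2) ddR).trans (by omega))
  have nA3 : (derivative (derivative (derivative A))).natDegree ≤ n - 4 := by
    have h1 := natDegree_derivative_le A
    have h2 := natDegree_derivative_le (derivative A)
    have h3 := natDegree_derivative_le (derivative (derivative A))
    omega
  have z3 : ZeroBound (logComb (derivative (derivative (derivative A))) B3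
      (derivative (derivative (derivative R))) (1 / 2 - (2 + 1 : ℕ))) (n - 4 + (n - 4 + 6)) := by
    refine (zeroBound_add_mul_rpow nA3 nB3).congr fun x _ => ?_
    rw [logComb, dddR, show (1 / 2 - ((2 + 1 : ℕ) : ℝ)) = -(5 / 2) by norm_num]
    simp
  have z1 := (z3.of_hasDerivAt fun x hx => hasDerivAt_logComb _ B2 _ 2 hx).of_hasDerivAt
    fun x hx => hasDerivAt_logComb _ B1 _ 1 hx
  have hd : ∀ x, 0 < x → HasDerivAt (logComb A B R (1 / 2))
      (logComb (derivative A) B1 (derivative R) (1 / 2 - (0 + 1 : ℕ)) x) x := by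
    intro x hx
    have := hasDerivAt_logComb A B R 0 hx
    rw [← hB1] at this
    rwa [show (1 / 2 - ((0 : ℕ) : ℝ)) = 1 / 2 by norm_num] at this
  rcases z1 with z1 | z1
  · rcases T.eq_empty_or_nonempty with rfl | ⟨a, ha⟩
    · simp
    · exact absurd (logComb_half_eq_zero fun x hx =>
        eq_zero_of_hasDerivAt_zero hd z1 (hT a ha).1 (hT a ha).2 hx) hne
  · have h0 : (0 : ℝ) ∉ T := fun h => lt_irrefl _ (hT 0 h).1
    have hnn : ∀ x ∈ insert 0 T, 0 ≤ x := by
      intro x hx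
      rcases Finset.mem_insert.1 hx with rfl | hx
      · exact le_rfl
      · exact (hT x hx).1.le
    have hcont : ContinuousOn (logComb A B R (1 / 2)) (Set.Ici 0) := by
      have e : logComb A B R (1 / 2) = fun x => A.eval x + B.eval x * √(x * (4 + x)) +
          R.eval x * Real.log ((2 + x + √(x * (4 + x))) / 2) := by
        funext x; rw [logComb, sqrt_eq_radicand_rpow]
      rw [e]
      refine ContinuousOn.add (by fun_prop) (ContinuousOn.mul (by fun_prop)
        (ContinuousOn.log (by fun_prop) fun x hx => ?_))
      have hx : 0 ≤ x := hx
      positivity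
    obtain ⟨t, ht, hcard⟩ := exists_finset_deriv_zeros (insert 0 T) (f := logComb A B R (1 / 2))
      (f' := logComb (derivative A) B1 (derivative R) (1 / 2 - (0 + 1 : ℕ)))
      (by
        intro a ha
        rcases Finset.mem_insert.1 ha with rfl | ha
        · rw [logComb, hA0, ← sqrt_eq_radicand_rpow]; simp
        · exact (hT a ha).2)
      (fun a ha b _ => hcont.mono fun x hx => (hnn a ha).trans hx.1)
      (fun a ha x hx => hd x ((hnn a ha).trans_lt hx))
    have := z1 t fun y hy => by
      obtain ⟨h1, ⟨a, ha, hay⟩, -⟩ := ht y hy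
      exact ⟨(hnn a ha).trans_lt hay, h1⟩
    rw [Finset.card_insert_of_notMem h0] at hcard
    omega

end LogCombination

/-- Let `n ≥ 4` and let `α_0,…,α_{n−2}, β_0,…,β_{n−2}, γ_0, γ_1, γ_2` be
reals, not all zero. Then
`F(h) = Σ_{k=0}^{n−2} α_k h^{k+1} + √(h(4+h)) Σ_{k=0}^{n−2} β_k h^k
  + (γ_0 + γ_1 h + γ_2 h²) ln((2 + h + √(h(4+h)))/2)`
has at most `2n` zeros in `(0,∞)`. -/
theorem stmt11 (n : ℕ) (hn : 4 ≤ n) (α β : ℕ → ℝ) (γ0 γ1 γ2 : ℝ)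
    (hne : ¬ ((∀ k ≤ n - 2, α k = 0) ∧ (∀ k ≤ n - 2, β k = 0) ∧
      γ0 = 0 ∧ γ1 = 0 ∧ γ2 = 0)) :
    ∀ T : Finset ℝ,
      (∀ h ∈ T, h ∈ Set.Ioi (0 : ℝ) ∧
        (∑ k ∈ Finset.range (n - 1), α k * h ^ (k + 1))
          + Real.sqrt (h * (4 + h)) * (∑ k ∈ Finset.range (n - 1), β k * h ^ k)
          + (γ0 + γ1 * h + γ2 * h ^ 2) *
              Real.log ((2 + h + Real.sqrt (h * (4 + h))) / 2) = 0) →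
      T.card ≤ 2 * n := by
  intro T hT
  set A : Polynomial ℝ :=
    ∑ k ∈ Finset.range (n - 1), Polynomial.C (α k) * Polynomial.X ^ (k + 1) with hA
  set B : Polynomial ℝ :=
    ∑ k ∈ Finset.range (n - 1), Polynomial.C (β k) * Polynomial.X ^ k with hB
  set R : Polynomial ℝ :=
    Polynomial.C γ0 + Polynomial.C γ1 * Polynomial.X + Polynomial.C γ2 * Polynomial.X ^ 2 with hR
  refine card_zeros_logComb_le (A := A) (B := B) (R := R) hn ?_ ?_ ?_ ?_ ?_ T ?_
  · refine Polynomial.natDegree_sum_le_of_forall_le _ _ fun k hk => ?_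
    have := Finset.mem_range.1 hk
    exact (Polynomial.natDegree_C_mul_X_pow_le _ _).trans (by omega)
  · simp [hA, Polynomial.eval_finsetSum]
  · refine Polynomial.natDegree_sum_le_of_forall_le _ _ fun k hk => ?_
    have := Finset.mem_range.1 hk
    exact (Polynomial.natDegree_C_mul_X_pow_le _ _).trans (by omega)
  · rw [hR]; compute_degree
  · rintro ⟨hA0, hB0, hR0⟩
    refine hne ⟨fun k hk => ?_, fun k hk => ?_, ?_, ?_, ?_⟩
    · have h := congrArg (fun p => p.coeff (k + 1)) hA0
      simpa [hA, Polynomial.finsetSum_coeff, Polynomial.coeff_X_pow,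
        show k < n - 1 by omega] using h
    · have h := congrArg (fun p => p.coeff k) hB0
      simpa [hB, Polynomial.finsetSum_coeff, Polynomial.coeff_X_pow,
        show k < n - 1 by omega] using h
    · simpa [hR, Polynomial.coeff_X, Polynomial.coeff_C, Polynomial.coeff_X_pow]
        using congrArg (fun p => p.coeff 0) hR0
    · simpa [hR, Polynomial.coeff_X, Polynomial.coeff_C, Polynomial.coeff_X_pow]
        using congrArg (fun p => p.coeff 1) hR0
    · simpa [hR, Polynomial.coeff_X, Polynomial.coeff_C, Polynomial.coeff_X_pow]
        using congrArg (fun p => p.coeff 2) hR0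
  · intro x hx
    obtain ⟨h1, h2⟩ := hT x hx
    refine ⟨h1, ?_⟩
    rw [← h2, logComb, ← sqrt_eq_radicand_rpow]
    simp only [hA, hB, hR, Polynomial.eval_finsetSum, Polynomial.eval_add, Polynomial.eval_mul,
      Polynomial.eval_C, Polynomial.eval_pow, Polynomial.eval_X]
    ring
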